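/- Let m ≥ 3, β ∈ (0,1), γ ∈ (1,2), 1 ≤ ℓ ≤ m−2, ω₁ > 0, ω₂ > 0, and let d_i^+, d_i^-, e_i^+, e_i^- ≥ 0 (i = 1,…,m−1) be nonnegative reals, with D_± = diag(d_i^±) and E_± = diag(e_i^±). Set A_ℓ = ω₁(D_+ G_{β,ℓ} + D_- G_{β,ℓ}ᵀ) − ω₂(E_+ G_{γ,ℓ} + E_- G_{γ,ℓ}ᵀ). Then the matrix I + A_ℓ has strictly positive diagonal entries, nonpositive off-diagonal entries, is strictly diagonally dominant by rows, and is invertible. -/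

import Mathlib

open Matrix

/-- Grünwald coefficient `g_j^(s) = ((-1)^j / j!) * s(s-1)⋯(s-j+1)` (with `g_0 = 1`). -/
noncomputable def grunwald (s : ℝ) (j : ℕ) : ℝ :=
  (-1) ^ j / (Nat.factorial j : ℝ) * ∏ i ∈ Finset.range j, (s - i)

/-- The banded truncation `G_{β,ℓ}` of `G_β` (0-based indices `i, j`; 1-based index is
`i+1`): entry `g_{i-j}^{(β)}` on the subdiagonals `1 ≤ i-j ≤ ℓ-1`; diagonal entry `1`
for `i+1 ≤ ℓ` and `1 + ∑_{k=ℓ}^{i} g_k^{(β)}` for `i+1 > ℓ`; all other entries `0`. -/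
noncomputable def GbetaL (β : ℝ) (ℓ m : ℕ) : Matrix (Fin (m - 1)) (Fin (m - 1)) ℝ :=
  fun i j =>
    if (i : ℕ) = (j : ℕ) then
      (if (i : ℕ) + 1 ≤ ℓ then 1 else 1 + ∑ k ∈ Finset.Ico ℓ ((i : ℕ) + 1), grunwald β k)
    else if (j : ℕ) < (i : ℕ) ∧ (i : ℕ) - (j : ℕ) ≤ ℓ - 1 then
      grunwald β ((i : ℕ) - (j : ℕ))
    else 0

/-- The banded truncation `G_{γ,ℓ}` of `G_γ` (0-based indices `i, j`): entry
`g_0^{(γ)}` on the superdiagonal `j = i+1`; entry `g_{i-j+1}^{(γ)}` on the subdiagonals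
`1 ≤ i-j ≤ ℓ-1`; diagonal entry `g_1^{(γ)}` for `i+1 ≤ ℓ` and
`g_1^{(γ)} + ∑_{k=ℓ+1}^{i+1} g_k^{(γ)}` for `i+1 > ℓ`; all other entries `0`. -/
noncomputable def GgammaL (γ : ℝ) (ℓ m : ℕ) : Matrix (Fin (m - 1)) (Fin (m - 1)) ℝ :=
  fun i j =>
    if (i : ℕ) = (j : ℕ) then
      (if (i : ℕ) + 1 ≤ ℓ then grunwald γ 1
       else grunwald γ 1 + ∑ k ∈ Finset.Ico (ℓ + 1) ((i : ℕ) + 2), grunwald γ k)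
    else if (j : ℕ) = (i : ℕ) + 1 then grunwald γ 0
    else if (j : ℕ) < (i : ℕ) ∧ (i : ℕ) - (j : ℕ) ≤ ℓ - 1 then
      grunwald γ ((i : ℕ) - (j : ℕ) + 1)
    else 0

theorem grunwald_zero (s : ℝ) : grunwald s 0 = 1 := by
  simp [grunwald]

theorem grunwald_succ (s : ℝ) (n : ℕ) :
    grunwald s (n + 1) = grunwald s n * ((n - s) / (n + 1)) := by
  have hn : (n : ℝ) + 1 ≠ 0 := by positivity
  have hf : (n.factorial : ℝ) ≠ 0 := by positivity
  simp only [grunwald, Finset.prod_range_succ, pow_succ, Nat.factorial_succ]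
  push_cast
  field_simp
  ring

theorem grunwald_succ' (s : ℝ) (n : ℕ) :
    grunwald s (n + 1) = -(s / (n + 1)) * grunwald (s - 1) n := by
  have hn : (n : ℝ) + 1 ≠ 0 := by positivity
  have hf : (n.factorial : ℝ) ≠ 0 := by positivity
  have hp : ∏ i ∈ Finset.range n, (s - ((i + 1 : ℕ) : ℝ)) =
      ∏ i ∈ Finset.range n, (s - 1 - i) :=
    Finset.prod_congr rfl fun i _ => by push_cast; ring
  simp only [grunwald, Finset.prod_range_succ', hp, pow_succ, Nat.factorial_succ]
  push_cast
  field_simp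
  ring

theorem sum_range_succ_grunwald (s : ℝ) (n : ℕ) :
    ∑ k ∈ Finset.range (n + 1), grunwald s k = grunwald (s - 1) n := by
  induction n with
  | zero => simp [grunwald_zero]
  | succ n ih =>
    have hn : (n : ℝ) + 1 ≠ 0 := by positivity
    rw [Finset.sum_range_succ, ih, grunwald_succ', grunwald_succ (s - 1)]
    field_simp
    ring

theorem grunwald_nonneg_of_nonpos {s : ℝ} (hs : s ≤ 0) (n : ℕ) : 0 ≤ grunwald s n := by
  induction n with
  | zero => simp [grunwald_zero]
  | succ n ih =>
    rw [grunwald_succ]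
    have : 0 ≤ (n : ℝ) - s := by linarith [n.cast_nonneg (α := ℝ)]
    positivity

theorem grunwald_nonpos {s : ℝ} (h0 : 0 ≤ s) (h1 : s ≤ 1) {n : ℕ} (hn : n ≠ 0) :
    grunwald s n ≤ 0 := by
  obtain ⟨n, rfl⟩ := Nat.exists_eq_succ_of_ne_zero hn
  rw [Nat.succ_eq_add_one, grunwald_succ', neg_mul, neg_nonpos]
  have := grunwald_nonneg_of_nonpos (sub_nonpos.2 h1) n
  positivity

theorem grunwald_nonneg {s : ℝ} (h1 : 1 ≤ s) (h2 : s ≤ 2) {n : ℕ} (hn : n ≠ 1) :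
    0 ≤ grunwald s n := by
  rcases n with _ | n
  · simp [grunwald_zero]
  · rw [grunwald_succ']
    have := grunwald_nonpos (s := s - 1) (n := n) (by linarith) (by linarith) (by omega)
    exact mul_nonneg_of_nonpos_of_nonpos (neg_nonpos.2 (by positivity)) this

/-- A sum along an injective reindexing into `s` is at most the sum over `s`
when the weights are nonnegative. -/
theorem sum_ite_le_sum_of_injective {ι κ : Type*} [Fintype ι] [DecidableEq κ]
    (P : ι → Prop) [DecidablePred P] (φ : ι → κ) (s : Finset κ) (c : κ → ℝ)
    (hmap : ∀ j, P j → φ j ∈ s) (hinj : ∀ j k, P j → P k → φ j = φ k → j = k)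
    (hc : ∀ k ∈ s, 0 ≤ c k) :
    ∑ j, (if P j then c (φ j) else 0) ≤ ∑ k ∈ s, c k := by
  rw [← Finset.sum_filter,
    ← Finset.sum_image (s := Finset.univ.filter P) (g := φ) (f := c) (by
      intro j hj k hk h
      exact hinj j k (Finset.mem_filter.1 hj).2 (Finset.mem_filter.1 hk).2 h)]
  refine Finset.sum_le_sum_of_subset_of_nonneg ?_ fun k hk _ => hc k hk
  intro k hk
  simp only [Finset.mem_image, Finset.mem_filter, Finset.mem_univ, true_and] at hk
  obtain ⟨j, hj, rfl⟩ := hk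
  exact hmap j hj

section Beta

variable {β : ℝ} {ℓ m : ℕ}

theorem GbetaL_eq (i j : Fin (m - 1)) :
    GbetaL β ℓ m i j = (if j = i then GbetaL β ℓ m i i else 0) -
      if (j : ℕ) < i ∧ (i : ℕ) - j < ℓ then -grunwald β ((i : ℕ) - j) else 0 := by
  by_cases h : i = j
  · subst h
    simp
  · have h' : (i : ℕ) ≠ j := fun e => h (Fin.ext e)
    have hiff : (j : ℕ) < i ∧ (i : ℕ) - j ≤ ℓ - 1 ↔ (j : ℕ) < i ∧ (i : ℕ) - j < ℓ := by omega
    rw [if_neg (Ne.symm h)]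
    simp only [GbetaL, if_neg h', hiff]
    split_ifs <;> simp

theorem GbetaL_nonpos (hβ : β ∈ Set.Ioo (0 : ℝ) 1) {i j : Fin (m - 1)} (h : i ≠ j) :
    GbetaL β ℓ m i j ≤ 0 := by
  rw [GbetaL_eq, if_neg h.symm]
  split_ifs with hj
  · have := grunwald_nonpos hβ.1.le hβ.2.le (n := (i : ℕ) - j) (by omega)
    linarith
  · simp

theorem GbetaL_diag_ge (hβ : β ∈ Set.Ioo (0 : ℝ) 1) (hℓ : 1 ≤ ℓ) (i : Fin (m - 1)) :
    ∑ k ∈ Finset.Ico 1 ℓ, -grunwald β k ≤ GbetaL β ℓ m i i := by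
  have key : ∀ n, 1 ≤ n → 0 ≤ 1 + ∑ k ∈ Finset.Ico 1 n, grunwald β k := by
    intro n hn
    obtain ⟨n, rfl⟩ := Nat.exists_eq_add_of_le' hn
    have := sum_range_succ_grunwald β n
    rw [Finset.range_eq_Ico, Finset.sum_eq_sum_Ico_succ_bot (by omega), grunwald_zero] at this
    rw [zero_add] at this
    rw [this]
    exact grunwald_nonneg_of_nonpos (by linarith [hβ.2]) n
  simp only [GbetaL, if_true, Finset.sum_neg_distrib]
  split_ifs with h
  · linarith [key ℓ hℓ]
  · have h1 := key ((i : ℕ) + 1) (by omega)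
    rw [← Finset.sum_Ico_consecutive _ hℓ (by omega)] at h1
    linarith

theorem GbetaL_row_sum_nonneg (hβ : β ∈ Set.Ioo (0 : ℝ) 1) (hℓ : 1 ≤ ℓ) (i : Fin (m - 1)) :
    0 ≤ ∑ j, GbetaL β ℓ m i j := by
  rw [Finset.sum_congr rfl fun j _ => GbetaL_eq i j, Finset.sum_sub_distrib,
    Finset.sum_ite_eq' Finset.univ i, if_pos (Finset.mem_univ _),
    sub_nonneg]
  refine le_trans ?_ (GbetaL_diag_ge hβ hℓ i)
  refine sum_ite_le_sum_of_injective (fun j : Fin (m - 1) => (j : ℕ) < i ∧ (i : ℕ) - j < ℓ)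
    (fun j => (i : ℕ) - j) _ (fun k => -grunwald β k) ?_ ?_ ?_
  · intro j hj
    simp only [Finset.mem_Ico]
    omega
  · intro j k hj hk h
    apply Fin.ext
    omega
  · intro k hk
    rw [Finset.mem_Ico] at hk
    exact neg_nonneg.2 (grunwald_nonpos hβ.1.le hβ.2.le (by omega))

theorem GbetaL_col_sum_nonneg (hβ : β ∈ Set.Ioo (0 : ℝ) 1) (hℓ : 1 ≤ ℓ) (i : Fin (m - 1)) :
    0 ≤ ∑ j, GbetaL β ℓ m j i := by
  rw [Finset.sum_congr rfl fun j _ => GbetaL_eq j i, Finset.sum_sub_distrib,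
    Finset.sum_ite_eq Finset.univ i (fun j => GbetaL β ℓ m j j),
    if_pos (Finset.mem_univ _), sub_nonneg]
  refine le_trans ?_ (GbetaL_diag_ge hβ hℓ i)
  refine sum_ite_le_sum_of_injective (fun j : Fin (m - 1) => (i : ℕ) < j ∧ (j : ℕ) - i < ℓ)
    (fun j => (j : ℕ) - i) _ (fun k => -grunwald β k) ?_ ?_ ?_
  · intro j hj
    simp only [Finset.mem_Ico]
    omega
  · intro j k hj hk h
    apply Fin.ext
    omega
  · intro k hk
    rw [Finset.mem_Ico] at hk
    exact neg_nonneg.2 (grunwald_nonpos hβ.1.le hβ.2.le (by omega))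

end Beta

section Gamma

variable {γ : ℝ} {ℓ m : ℕ}

theorem GgammaL_eq (hℓ : 1 ≤ ℓ) (i j : Fin (m - 1)) :
    GgammaL γ ℓ m i j = (if j = i then GgammaL γ ℓ m i i else 0) +
      if (i : ℕ) ≠ j ∧ (j : ℕ) ≤ i + 1 ∧ (i : ℕ) + 1 - j ≤ ℓ then
        grunwald γ ((i : ℕ) + 1 - j) else 0 := by
  by_cases h : i = j
  · subst h
    simp
  · have h' : (i : ℕ) ≠ j := fun e => h (Fin.ext e)
    rw [if_neg (Ne.symm h), zero_add]
    simp only [GgammaL, if_neg h']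
    by_cases h1 : (j : ℕ) = i + 1
    · rw [if_pos h1, if_pos (by omega), show (i : ℕ) + 1 - j = 0 by omega]
    · rw [if_neg h1]
      by_cases h2 : (j : ℕ) < i ∧ (i : ℕ) - j ≤ ℓ - 1
      · rw [if_pos h2, if_pos (by omega), show (i : ℕ) + 1 - j = i - j + 1 by omega]
      · rw [if_neg h2, if_neg (by omega)]

theorem GgammaL_nonneg (hγ : γ ∈ Set.Ioo (1 : ℝ) 2) (hℓ : 1 ≤ ℓ) {i j : Fin (m - 1)}
    (h : i ≠ j) : 0 ≤ GgammaL γ ℓ m i j := by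
  rw [GgammaL_eq hℓ, if_neg h.symm, zero_add]
  split_ifs with hj
  · exact grunwald_nonneg hγ.1.le hγ.2.le (by omega)
  · exact le_rfl

theorem GgammaL_diag_add_nonpos (hγ : γ ∈ Set.Ioo (1 : ℝ) 2) (hℓ : 1 ≤ ℓ) (i : Fin (m - 1)) :
    GgammaL γ ℓ m i i + ∑ k ∈ (Finset.range (ℓ + 1)).erase 1, grunwald γ k ≤ 0 := by
  have key : ∀ n, n ≠ 0 → ∑ k ∈ Finset.range (n + 1), grunwald γ k ≤ 0 := by
    intro n hn
    rw [sum_range_succ_grunwald]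
    exact grunwald_nonpos (by linarith [hγ.1]) (by linarith [hγ.2]) hn
  have he := Finset.add_sum_erase (Finset.range (ℓ + 1)) (grunwald γ) (a := 1)
    (by rw [Finset.mem_range]; omega)
  simp only [GgammaL, if_true]
  split_ifs with h
  · linarith [key ℓ (by omega)]
  · have h1 := key ((i : ℕ) + 1) (by omega)
    rw [← Finset.sum_range_add_sum_Ico _ (show ℓ + 1 ≤ (i : ℕ) + 1 + 1 by omega)] at h1
    linarith

theorem GgammaL_row_sum_nonpos (hγ : γ ∈ Set.Ioo (1 : ℝ) 2) (hℓ : 1 ≤ ℓ) (i : Fin (m - 1)) :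
    ∑ j, GgammaL γ ℓ m i j ≤ 0 := by
  rw [Finset.sum_congr rfl fun j _ => GgammaL_eq hℓ i j, Finset.sum_add_distrib,
    Finset.sum_ite_eq' Finset.univ i, if_pos (Finset.mem_univ _)]
  refine le_trans (add_le_add_right ?_ _) (GgammaL_diag_add_nonpos hγ hℓ i)
  refine sum_ite_le_sum_of_injective
    (fun j : Fin (m - 1) => (i : ℕ) ≠ j ∧ (j : ℕ) ≤ i + 1 ∧ (i : ℕ) + 1 - j ≤ ℓ)
    (fun j => (i : ℕ) + 1 - j) _ (grunwald γ) ?_ ?_ ?_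
  · intro j hj
    simp only [Finset.mem_erase, Finset.mem_range]
    omega
  · intro j k hj hk h
    apply Fin.ext
    omega
  · intro k hk
    exact grunwald_nonneg hγ.1.le hγ.2.le (Finset.ne_of_mem_erase hk)

theorem GgammaL_col_sum_nonpos (hγ : γ ∈ Set.Ioo (1 : ℝ) 2) (hℓ : 1 ≤ ℓ) (i : Fin (m - 1)) :
    ∑ j, GgammaL γ ℓ m j i ≤ 0 := by
  rw [Finset.sum_congr rfl fun j _ => GgammaL_eq hℓ j i, Finset.sum_add_distrib,
    Finset.sum_ite_eq Finset.univ i (fun j => GgammaL γ ℓ m j j),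
    if_pos (Finset.mem_univ _)]
  refine le_trans (add_le_add_right ?_ _) (GgammaL_diag_add_nonpos hγ hℓ i)
  refine sum_ite_le_sum_of_injective
    (fun j : Fin (m - 1) => (j : ℕ) ≠ i ∧ (i : ℕ) ≤ j + 1 ∧ (j : ℕ) + 1 - i ≤ ℓ)
    (fun j => (j : ℕ) + 1 - i) _ (grunwald γ) ?_ ?_ ?_
  · intro j hj
    simp only [Finset.mem_erase, Finset.mem_range]
    omega
  · intro j k hj hk h
    apply Fin.ext
    omega
  · intro k hk
    exact grunwald_nonneg hγ.1.le hγ.2.le (Finset.ne_of_mem_erase hk)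

end Gamma

/-- A real matrix with nonpositive off-diagonal entries and positive row sums is strictly
diagonally dominant by rows. -/
theorem sum_abs_erase_lt_diag {n : Type*} [Fintype n] [DecidableEq n] {M : Matrix n n ℝ}
    (hoff : ∀ i j, i ≠ j → M i j ≤ 0) (hrow : ∀ i, 0 < ∑ j, M i j) (i : n) :
    ∑ j ∈ Finset.univ.erase i, |M i j| < M i i := by
  have h1 : ∑ j ∈ Finset.univ.erase i, |M i j| = -∑ j ∈ Finset.univ.erase i, M i j := by
    rw [← Finset.sum_neg_distrib]
    exact Finset.sum_congr rfl fun j hj =>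
      abs_of_nonpos (hoff i j (Finset.ne_of_mem_erase hj).symm)
  have h2 := Finset.add_sum_erase Finset.univ (M i) (Finset.mem_univ i)
  linarith [hrow i]

theorem stmt16 (m ℓ : ℕ) (hm : 3 ≤ m) (hℓ : 1 ≤ ℓ) (hℓm : ℓ ≤ m - 2)
    (β γ ω₁ ω₂ : ℝ)
    (hβ : β ∈ Set.Ioo (0 : ℝ) 1) (hγ : γ ∈ Set.Ioo (1 : ℝ) 2)
    (hω₁ : 0 < ω₁) (hω₂ : 0 < ω₂)
    (dp dm ep em : Fin (m - 1) → ℝ)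
    (hdp : ∀ i, 0 ≤ dp i) (hdm : ∀ i, 0 ≤ dm i)
    (hep : ∀ i, 0 ≤ ep i) (hem : ∀ i, 0 ≤ em i) :
    let Aℓ : Matrix (Fin (m - 1)) (Fin (m - 1)) ℝ :=
      ω₁ • (Matrix.diagonal dp * GbetaL β ℓ m + Matrix.diagonal dm * (GbetaL β ℓ m)ᵀ) -
        ω₂ • (Matrix.diagonal ep * GgammaL γ ℓ m + Matrix.diagonal em * (GgammaL γ ℓ m)ᵀ)
    let M : Matrix (Fin (m - 1)) (Fin (m - 1)) ℝ := 1 + Aℓ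
    (∀ i, 0 < M i i) ∧
    (∀ i j, i ≠ j → M i j ≤ 0) ∧
    (∀ i, ∑ j ∈ Finset.univ.erase i, |M i j| < M i i) ∧
    IsUnit M := by
  intro Aℓ M
  have hM : ∀ i j, M i j = (1 : Matrix (Fin (m - 1)) (Fin (m - 1)) ℝ) i j +
      (ω₁ * (dp i * GbetaL β ℓ m i j + dm i * GbetaL β ℓ m j i) -
        ω₂ * (ep i * GgammaL γ ℓ m i j + em i * GgammaL γ ℓ m j i)) := by
    intro i j
    simp [M, Aℓ, Matrix.diagonal_mul]
    ring
  have hoff : ∀ i j, i ≠ j → M i j ≤ 0 := by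
    intro i j hij
    rw [hM, Matrix.one_apply_ne hij]
    have h1 := mul_nonpos_of_nonneg_of_nonpos (hdp i) (GbetaL_nonpos (ℓ := ℓ) hβ hij)
    have h2 := mul_nonpos_of_nonneg_of_nonpos (hdm i) (GbetaL_nonpos (ℓ := ℓ) hβ hij.symm)
    have h3 := mul_nonneg (hep i) (GgammaL_nonneg hγ hℓ hij)
    have h4 := mul_nonneg (hem i) (GgammaL_nonneg hγ hℓ hij.symm)
    have h5 := mul_nonpos_of_nonneg_of_nonpos hω₁.le (add_nonpos h1 h2)
    have h6 := mul_nonneg hω₂.le (add_nonneg h3 h4)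
    linarith
  have hrow : ∀ i, 0 < ∑ j, M i j := by
    intro i
    simp_rw [hM, Finset.sum_add_distrib, Finset.sum_sub_distrib, ← Finset.mul_sum,
      Finset.sum_add_distrib, ← Finset.mul_sum]
    have h0 : ∑ j, (1 : Matrix (Fin (m - 1)) (Fin (m - 1)) ℝ) i j = 1 := by
      simp [Matrix.one_apply]
    have h1 := mul_nonneg (hdp i) (GbetaL_row_sum_nonneg hβ hℓ i)
    have h2 := mul_nonneg (hdm i) (GbetaL_col_sum_nonneg hβ hℓ i)
    have h3 := mul_nonpos_of_nonneg_of_nonpos (hep i) (GgammaL_row_sum_nonpos hγ hℓ i)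
    have h4 := mul_nonpos_of_nonneg_of_nonpos (hem i) (GgammaL_col_sum_nonpos hγ hℓ i)
    have h5 := mul_nonneg hω₁.le (add_nonneg h1 h2)
    have h6 := mul_nonpos_of_nonneg_of_nonpos hω₂.le (add_nonpos h3 h4)
    linarith
  have hdom := sum_abs_erase_lt_diag hoff hrow
  have hdiag : ∀ i, 0 < M i i := fun i =>
    (Finset.sum_nonneg fun j _ => abs_nonneg (M i j)).trans_lt (hdom i)
  refine ⟨hdiag, hoff, hdom, ?_⟩
  rw [Matrix.isUnit_iff_isUnit_det, isUnit_iff_ne_zero]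
  refine det_ne_zero_of_sum_row_lt_diag fun i => ?_
  simpa only [Real.norm_eq_abs, abs_of_pos (hdiag i)] using hdom i
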